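/- arXiv:1703.06821 — 2 statements merged into one kernel-verified Lean document; each statement's English description precedes it below -/
import Mathlib

section
/- Let K be a field, m ≥ 2 a natural number, and β a nondegenerate alternating bilinear form on the K-vector space V₀ = K^{2m}. Define χ on V := V₀ × K by χ((x,a), (y,b), (z,c)) := a·β(y,z) − b·β(x,z) + c·β(x,y). Then χ is an alternating trilinear form on V; a nonzero (u,a) ∈ V is a pole of χ if and only if a = 0, in which case Rad_χ((u,0)) = {(v,0) : β(u,v) = 0} has dimension 2m − 1; and a 2-dimensional subspace ℓ of V lies in the upper radical R↑(χ) if and only if ℓ ⊆ V₀ × {0} and β(x, y) = 0 for all (x,0), (y,0) ∈ ℓ (i.e., the geometry of poles of χ is the nondegenerate symplectic polar space of β on V₀). -/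
open Module

/-- The radical of a point `u` with respect to an alternating trilinear form `χ` on `V`:
the subspace `Rad_χ(u) = {v ∈ V | χ(u, v, x) = 0 for all x ∈ V}`. -/
def trilinRad {K V : Type*} [Field K] [AddCommGroup V] [Module K V]
    (χ : AlternatingMap K V K (Fin 3)) (u : V) : Submodule K V where
  carrier := {v | ∀ x : V, χ ![u, v, x] = 0}
  add_mem' := by
    intro a b ha hb x
    have h1 : (![u, a + b, x] : Fin 3 → V) = Function.update ![u, a, x] 1 (a + b) := by
      funext i; fin_cases i <;> simp
    have h2 : Function.update (![u, a, x] : Fin 3 → V) 1 a = ![u, a, x] := by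
      funext i; fin_cases i <;> simp
    have h3 : Function.update (![u, a, x] : Fin 3 → V) 1 b = ![u, b, x] := by
      funext i; fin_cases i <;> simp
    calc χ ![u, a + b, x]
        = χ (Function.update ![u, a, x] 1 (a + b)) := by rw [h1]
      _ = χ (Function.update ![u, a, x] 1 a) + χ (Function.update ![u, a, x] 1 b) := by
          rw [AlternatingMap.map_update_add]
      _ = 0 := by rw [h2, h3, ha x, hb x, add_zero]
  zero_mem' := by
    intro x
    exact AlternatingMap.map_coord_zero χ 1 (by simp)
  smul_mem' := by
    intro c a ha x
    have h1 : (![u, c • a, x] : Fin 3 → V) = Function.update ![u, a, x] 1 (c • a) := by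
      funext i; fin_cases i <;> simp
    have h2 : Function.update (![u, a, x] : Fin 3 → V) 1 a = ![u, a, x] := by
      funext i; fin_cases i <;> simp
    rw [h1, AlternatingMap.map_update_smul, h2, ha x, smul_zero]

/-- The basic alternating trilinear form `[ijk]` on `K^n`, sending `(x, y, z)` to the
determinant of the 3×3 matrix with rows `(x i, x j, x k)`, `(y i, y j, y k)`,
`(z i, z j, z k)`.  (Indices are 0-based: the form written `[123]` in the paper is
`trip 0 1 2`.) -/
noncomputable def trip {K : Type*} [Field K] {n : ℕ} (i j k : Fin n) :
    AlternatingMap K (Fin n → K) K (Fin 3) :=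
  (Matrix.detRowAlternating : AlternatingMap K (Fin 3 → K) K (Fin 3)).compLinearMap
    (LinearMap.funLeft K K ![i, j, k])

/-- The alternating trilinear form
`((x, a), (y, b), (z, c)) ↦ a β(y, z) - b β(x, z) + c β(x, y)` on `V × K` attached to an
alternating bilinear form `β` on `V`. -/
def trilinExpansion {K V : Type*} [Field K] [AddCommGroup V] [Module K V]
    (β : V →ₗ[K] V →ₗ[K] K) (halt : ∀ x, β x x = 0) :
    AlternatingMap K (V × K) K (Fin 3) where
  toFun w := (w 0).2 * β (w 1).1 (w 2).1 - (w 1).2 * β (w 0).1 (w 2).1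
    + (w 2).2 * β (w 0).1 (w 1).1
  map_update_add' := by
    intro inst w i x y
    obtain rfl := Subsingleton.elim inst (instDecidableEqFin 3)
    fin_cases i <;> simp <;> ring
  map_update_smul' := by
    intro inst w i c x
    obtain rfl := Subsingleton.elim inst (instDecidableEqFin 3)
    fin_cases i <;> simp <;> ring
  map_eq_zero_of_eq' := by
    intro w i j hw hij
    have hskew : ∀ x y, β x y = -β y x :=
      fun x y => (LinearMap.IsAlt.neg (B := β) halt y x).symm
    fin_cases i <;> fin_cases j <;> simp at hij hw ⊢ <;>
      simp only [hw, halt, hskew (w 1).1 (w 0).1] <;>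
      first | ring1 | linear_combination (w 2).2 * hskew (w 2).1 (w 1).1

section

variable {K V : Type*} [Field K] [AddCommGroup V] [Module K V]
  (β : V →ₗ[K] V →ₗ[K] K) (halt : ∀ x, β x x = 0)

theorem trilinExpansion_apply (p q r : V × K) :
    trilinExpansion β halt ![p, q, r] =
      p.2 * β q.1 r.1 - q.2 * β p.1 r.1 + r.2 * β p.1 q.1 :=
  rfl

theorem mem_trilinRad {χ : AlternatingMap K V K (Fin 3)} {u v : V} :
    v ∈ trilinRad χ u ↔ ∀ x, χ ![u, v, x] = 0 :=
  Iff.rfl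

/-- The radical condition for the expansion of `β`, tested on `V × 0` and `0 × K`. -/
theorem mem_trilinRad_trilinExpansion (hnd : ∀ u, (∀ v, β u v = 0) → u = 0) {p q : V × K} :
    q ∈ trilinRad (trilinExpansion β halt) p ↔
      p.2 • q.1 = q.2 • p.1 ∧ β p.1 q.1 = 0 := by
  simp only [mem_trilinRad, trilinExpansion_apply]
  constructor
  · intro h
    refine ⟨sub_eq_zero.mp (hnd _ fun v => ?_), by simpa using h (0, 1)⟩
    simpa using h (v, 0)
  · rintro ⟨h, h0⟩ x
    have h' := congrArg (fun w => β w x.1) h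
    simp only [map_smul, LinearMap.smul_apply, smul_eq_mul] at h'
    rw [h0, h', sub_self, mul_zero, add_zero]

theorem mem_trilinRad_trilinExpansion_zero (hnd : ∀ u, (∀ v, β u v = 0) → u = 0) {u : V}
    (hu : u ≠ 0) {q : V × K} :
    q ∈ trilinRad (trilinExpansion β halt) (u, 0) ↔ q.2 = 0 ∧ β u q.1 = 0 := by
  rw [mem_trilinRad_trilinExpansion β halt hnd, zero_smul, eq_comm, smul_eq_zero_iff_left hu]

theorem finrank_trilinRad_trilinExpansion_zero [FiniteDimensional K V]
    (hnd : ∀ u, (∀ v, β u v = 0) → u = 0) {u : V} (hu : u ≠ 0) :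
    finrank K (trilinRad (trilinExpansion β halt) (u, 0)) = finrank K V - 1 := by
  have hmap : trilinRad (trilinExpansion β halt) (u, 0) =
      (LinearMap.ker (β u)).map (LinearMap.inl K V K) := by
    ext q
    rw [mem_trilinRad_trilinExpansion_zero β halt hnd hu]
    constructor
    · rintro ⟨h2, h1⟩
      exact ⟨q.1, h1, Prod.ext rfl h2.symm⟩
    · rintro ⟨v, hv, rfl⟩
      exact ⟨rfl, hv⟩
  have hβu : β u ≠ 0 := fun h => hu (hnd u fun v => by simp [h])
  rw [hmap, ← (Submodule.equivMapOfInjective _ LinearMap.inl_injective _).finrank_eq]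
  have := Module.Dual.finrank_ker_add_one_of_ne_zero hβu
  omega

/-- A vector outside `V × 0` is not a pole. -/
theorem finrank_trilinRad_trilinExpansion_le_one (hnd : ∀ u, (∀ v, β u v = 0) → u = 0)
    {p : V × K} (hp : p.2 ≠ 0) :
    finrank K (trilinRad (trilinExpansion β halt) p) ≤ 1 := by
  have hle : trilinRad (trilinExpansion β halt) p ≤ K ∙ p := by
    intro q hq
    obtain ⟨h, -⟩ := (mem_trilinRad_trilinExpansion β halt hnd).mp hq
    refine Submodule.mem_span_singleton.mpr ⟨q.2 / p.2, Prod.ext ?_ ?_⟩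
    · rw [Prod.smul_fst, div_eq_inv_mul, mul_smul, ← h, inv_smul_smul₀ hp]
    · simp [hp]
  exact (Submodule.finrank_mono hle).trans 
    (finrank_span_singleton (K := K) (v := p) fun h => hp (by rw [h, Prod.snd_zero])).le

/-- Cyclic invariance turns the upper radical condition into a radical condition. -/
theorem forall_trilinExpansion_eq_zero_iff {p q : V × K} :
    (∀ u, trilinExpansion β halt ![u, p, q] = 0) ↔
      q ∈ trilinRad (trilinExpansion β halt) p := by
  have hskew : ∀ x y, β x y = -β y x :=
      fun x y => (LinearMap.IsAlt.neg (B := β) halt y x).symm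
  rw [mem_trilinRad]
  refine forall_congr' fun u => ?_
  rw [trilinExpansion_apply, trilinExpansion_apply, hskew u.1 q.1, hskew u.1 p.1]
  ring_nf

theorem upperRadical_trilinExpansion_iff [FiniteDimensional K V]
    (hnd : ∀ u, (∀ v, β u v = 0) → u = 0)
    (ℓ : Submodule K (V × K)) (hℓ : finrank K ℓ = 2) :
    (∀ u, ∀ x ∈ ℓ, ∀ y ∈ ℓ, trilinExpansion β halt ![u, x, y] = 0) ↔
      (∀ w ∈ ℓ, w.2 = 0) ∧ ∀ x ∈ ℓ, ∀ y ∈ ℓ, β x.1 y.1 = 0 := by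
  constructor
  · intro h
    have hrad : ∀ x ∈ ℓ, ℓ ≤ trilinRad (trilinExpansion β halt) x := fun x hx y hy =>
      (forall_trilinExpansion_eq_zero_iff β halt).mp fun u => h u x hx y hy
    refine ⟨fun w hw => ?_, fun x hx y hy =>
      ((mem_trilinRad_trilinExpansion β halt hnd).mp (hrad x hx hy)).2⟩
    by_contra hw2
    have h1 := finrank_trilinRad_trilinExpansion_le_one β halt hnd hw2
    have h2 := Submodule.finrank_mono (hrad w hw)
    omega
  · rintro ⟨h1, h2⟩ u x hx y hy
    rw [trilinExpansion_apply, h1 x hx, h1 y hy, h2 x hx y hy]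
    ring

end

/-- the expansion `χ((x,a),(y,b),(z,c)) = a·β(y,z) − b·β(x,z) + c·β(x,y)`
of a nondegenerate alternating bilinear form `β` on `K^{2m}` is an alternating trilinear
form on `K^{2m} × K`; its poles are exactly the nonzero `(u, 0)`, with
`Rad((u,0)) = {(v,0) | β(u,v) = 0}` of dimension `2m − 1`; and its upper radical consists
of the 2-dimensional totally isotropic subspaces of `K^{2m} × {0}`. -/
theorem stmt7 (K : Type*) [Field K] (m : ℕ) (hm : 2 ≤ m)
    (β : (Fin (2 * m) → K) →ₗ[K] (Fin (2 * m) → K) →ₗ[K] K)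
    (halt : ∀ x, β x x = 0)
    (hnd : ∀ u, (∀ v, β u v = 0) → u = 0) :
    ∃ χ : AlternatingMap K ((Fin (2 * m) → K) × K) K (Fin 3),
      (∀ (x y z : Fin (2 * m) → K) (a b c : K),
        χ ![(x, a), (y, b), (z, c)] = a * β y z - b * β x z + c * β x y) ∧
      (∀ (u : Fin (2 * m) → K) (a : K), (u, a) ≠ 0 →
        (2 ≤ Module.finrank K (trilinRad χ (u, a)) ↔ a = 0)) ∧
      (∀ u : Fin (2 * m) → K, u ≠ 0 →
        ((∀ w : (Fin (2 * m) → K) × K,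
            w ∈ trilinRad χ (u, (0 : K)) ↔ (w.2 = 0 ∧ β u w.1 = 0)) ∧
          Module.finrank K (trilinRad χ (u, (0 : K))) = 2 * m - 1)) ∧
      (∀ ℓ : Submodule K ((Fin (2 * m) → K) × K), Module.finrank K ℓ = 2 →
        ((∀ u : (Fin (2 * m) → K) × K, ∀ x ∈ ℓ, ∀ y ∈ ℓ, χ ![u, x, y] = 0) ↔
          ((∀ w ∈ ℓ, ((w : (Fin (2 * m) → K) × K)).2 = 0) ∧
            ∀ x ∈ ℓ, ∀ y ∈ ℓ,
              β ((x : (Fin (2 * m) → K) × K)).1 ((y : (Fin (2 * m) → K) × K)).1 = 0))) := by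
  refine ⟨trilinExpansion β halt, fun x y z a b c => rfl, fun u a hua => ⟨fun h => ?_, ?_⟩,
    fun u hu => ⟨fun w => mem_trilinRad_trilinExpansion_zero β halt hnd hu, ?_⟩,
    upperRadical_trilinExpansion_iff β halt hnd⟩
  · by_contra ha
    have := finrank_trilinRad_trilinExpansion_le_one β halt hnd (p := (u, a)) ha
    omega
  · rintro rfl
    have hu : u ≠ 0 := fun h => hua (by rw [h, Prod.mk_zero_zero])
    rw [finrank_trilinRad_trilinExpansion_zero β halt hnd hu, finrank_fin_fun]
    omega
  · rw [finrank_trilinRad_trilinExpansion_zero β halt hnd hu, finrank_fin_fun]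
end

section
/- Let K be a field and λ ∈ K an element that is not a square in K (so that t² − λ is irreducible over K). Let V = K^6 and χ := [123] + λ·([156] + [345] + [426]). Then dim Rad_χ(u) = 2 for every nonzero u ∈ V; consequently the upper radical R↑(χ) = {Rad_χ(u) : u ∈ V, u ≠ 0} is a line spread of the projective space of V (every nonzero vector lies in exactly one member of R↑(χ)). -/
open Module

section ScalarExtension

variable {K : Type*} [Field K]

/-- Multiplication by `√lam` on `K^6`, identified with `K(√lam)^3` through
`u ↦ (u i + √lam * u (i + 3))`. -/
def sqrtMul (lam : K) (u : Fin 6 → K) : Fin 6 → K :=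
  ![lam * u 3, lam * u 4, lam * u 5, u 0, u 1, u 2]

/-- The trilinear form `[123] + lam * ([156] + [345] + [426])` on `K^6`. -/
noncomputable def extForm (lam : K) : AlternatingMap K (Fin 6 → K) K (Fin 3) :=
  trip 0 1 2 + lam • (trip 0 4 5 + trip 2 3 4 + trip 3 1 5)

theorem trip_apply {n : ℕ} (i j k : Fin n) (x y z : Fin n → K) :
    trip i j k ![x, y, z] = x i * (y j * z k - y k * z j) - x j * (y i * z k - y k * z i)
      + x k * (y i * z j - y j * z i) := by
  have h : trip i j k ![x, y, z] =
      Matrix.det !![x i, x j, x k; y i, y j, y k; z i, z j, z k] := by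
    change Matrix.det (n := Fin 3) (R := K) _ = _
    congr 1
    ext a b
    fin_cases a <;> fin_cases b <;> rfl
  rw [h, Matrix.det_fin_three]
  simp
  ring

theorem eq_zero_of_sq_eq_mul_sq {lam : K} (hlam : ∀ x : K, x ^ 2 ≠ lam) {a b : K}
    (h : a ^ 2 = lam * b ^ 2) : a = 0 ∧ b = 0 := by
  have hb : b = 0 := by
    by_contra hb
    exact hlam (a / b) (by field_simp; rw [h, mul_comm])
  exact ⟨by simpa [hb] using h, hb⟩

theorem exists_sq_sub_mul_sq_ne_zero {lam : K} (hlam : ∀ x : K, x ^ 2 ≠ lam) {u : Fin 6 → K}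
    (hu : u ≠ 0) :
    ∃ i : Fin 3, u (Fin.castAdd 3 i) ^ 2 - lam * u (Fin.natAdd 3 i) ^ 2 ≠ 0 := by
  by_contra! h
  refine hu ?_
  have h' := fun i => eq_zero_of_sq_eq_mul_sq hlam (sub_eq_zero.mp (h i))
  funext j
  exact Fin.addCases (m := 3) (n := 3) (motive := fun j => u j = 0)
    (fun i => (h' i).1) (fun i => (h' i).2) j

theorem sqrtMul_castAdd (lam : K) (u : Fin 6 → K) (i : Fin 3) :
    sqrtMul lam u (Fin.castAdd 3 i) = lam * u (Fin.natAdd 3 i) := by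
  fin_cases i <;> rfl

theorem sqrtMul_natAdd (lam : K) (u : Fin 6 → K) (i : Fin 3) :
    sqrtMul lam u (Fin.natAdd 3 i) = u (Fin.castAdd 3 i) := by
  fin_cases i <;> rfl

theorem smul_add_smul_sqrtMul_mem (lam : K) (u : Fin 6 → K) (c d : K) :
    c • u + d • sqrtMul lam u ∈ trilinRad (extForm lam) u := by
  intro x
  simp only [extForm, AlternatingMap.add_apply, AlternatingMap.smul_apply, trip_apply,
    Pi.add_apply, Pi.smul_apply, smul_eq_mul, sqrtMul, Matrix.cons_val]
  ring

/-- A vector of the radical of `u` has vanishing cross product with `u` over `K(√lam)`. -/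
theorem cross_eq_zero {lam : K} (h0 : lam ≠ 0) {u v : Fin 6 → K}
    (hv : v ∈ trilinRad (extForm lam) u) (i j : Fin 3) :
    u (Fin.castAdd 3 i) * v (Fin.castAdd 3 j) - u (Fin.castAdd 3 j) * v (Fin.castAdd 3 i)
      + lam * (u (Fin.natAdd 3 i) * v (Fin.natAdd 3 j)
        - u (Fin.natAdd 3 j) * v (Fin.natAdd 3 i)) = 0 ∧
    u (Fin.castAdd 3 i) * v (Fin.natAdd 3 j) - u (Fin.castAdd 3 j) * v (Fin.natAdd 3 i)
      + (u (Fin.natAdd 3 i) * v (Fin.castAdd 3 j)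
        - u (Fin.natAdd 3 j) * v (Fin.castAdd 3 i)) = 0 := by
  have e0 := hv ![1, 0, 0, 0, 0, 0]
  have e1 := hv ![0, 1, 0, 0, 0, 0]
  have e2 := hv ![0, 0, 1, 0, 0, 0]
  have e3 := hv ![0, 0, 0, 1, 0, 0]
  have e4 := hv ![0, 0, 0, 0, 1, 0]
  have e5 := hv ![0, 0, 0, 0, 0, 1]
  simp only [extForm, AlternatingMap.add_apply, AlternatingMap.smul_apply, smul_eq_mul,
    trip_apply, Matrix.cons_val] at e0 e1 e2 e3 e4 e5
  constructor
  · fin_cases i <;> fin_cases j <;>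
    simp only [Fin.castAdd, Fin.natAdd, Fin.castLE, Fin.zero_eta, Fin.mk_one, Fin.reduceFinMk,
      Fin.isValue, Nat.reduceAdd] <;>
    grind
  · apply mul_left_cancel₀ h0
    fin_cases i <;> fin_cases j <;>
    simp only [Fin.castAdd, Fin.natAdd, Fin.castLE, Fin.zero_eta, Fin.mk_one, Fin.reduceFinMk,
      Fin.isValue, Nat.reduceAdd] <;>
    grind

theorem mem_trilinRad_iff {lam : K} (hlam : ∀ x : K, x ^ 2 ≠ lam) {u : Fin 6 → K}
    (hu : u ≠ 0) (v : Fin 6 → K) :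
    v ∈ trilinRad (extForm lam) u ↔ ∃ c d : K, c • u + d • sqrtMul lam u = v := by
  refine ⟨fun hv => ?_, ?_⟩
  · have h0 : lam ≠ 0 := fun h => hlam 0 (by simp [h])
    obtain ⟨i, hi⟩ := exists_sq_sub_mul_sq_ne_zero hlam hu
    set p := u (Fin.castAdd 3 i)
    set q := u (Fin.natAdd 3 i)
    refine ⟨(v (Fin.castAdd 3 i) * p - lam * v (Fin.natAdd 3 i) * q) / (p ^ 2 - lam * q ^ 2),
      (v (Fin.natAdd 3 i) * p - v (Fin.castAdd 3 i) * q) / (p ^ 2 - lam * q ^ 2), ?_⟩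
    funext j
    refine Fin.addCases (m := 3) (n := 3) (motive := fun j => (_ : Fin 6 → K) j = v j)
      (fun j => ?_) (fun j => ?_) j
    · obtain ⟨h1, h2⟩ := cross_eq_zero h0 hv i j
      simp only [Pi.add_apply, Pi.smul_apply, smul_eq_mul, sqrtMul_castAdd]
      field_simp
      linear_combination (-p) * h1 + lam * q * h2
    · obtain ⟨h1, h2⟩ := cross_eq_zero h0 hv i j
      simp only [Pi.add_apply, Pi.smul_apply, smul_eq_mul, sqrtMul_natAdd]
      field_simp
      linear_combination q * h1 - p * h2
  · rintro ⟨c, d, rfl⟩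
    exact smul_add_smul_sqrtMul_mem lam u c d

theorem linearIndependent_sqrtMul {lam : K} (hlam : ∀ x : K, x ^ 2 ≠ lam) {u : Fin 6 → K}
    (hu : u ≠ 0) : LinearIndependent K ![u, sqrtMul lam u] := by
  rw [LinearIndependent.pair_iff]
  intro c d h
  obtain ⟨i, hi⟩ := exists_sq_sub_mul_sq_ne_zero hlam hu
  have h1 := congrFun h (Fin.castAdd 3 i)
  have h2 := congrFun h (Fin.natAdd 3 i)
  simp only [Pi.add_apply, Pi.smul_apply, smul_eq_mul, sqrtMul_castAdd, sqrtMul_natAdd,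
    Pi.zero_apply] at h1 h2
  constructor
  · refine (mul_eq_zero.mp ?_).resolve_right hi
    linear_combination u (Fin.castAdd 3 i) * h1 - lam * u (Fin.natAdd 3 i) * h2
  · refine (mul_eq_zero.mp ?_).resolve_right hi
    linear_combination u (Fin.castAdd 3 i) * h2 - u (Fin.natAdd 3 i) * h1

theorem trilinRad_eq_span {lam : K} (hlam : ∀ x : K, x ^ 2 ≠ lam) {u : Fin 6 → K}
    (hu : u ≠ 0) :
    trilinRad (extForm lam) u = Submodule.span K {u, sqrtMul lam u} := by
  ext v
  rw [mem_trilinRad_iff hlam hu, Submodule.mem_span_pair]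

theorem finrank_trilinRad {lam : K} (hlam : ∀ x : K, x ^ 2 ≠ lam) {u : Fin 6 → K}
    (hu : u ≠ 0) : Module.finrank K (trilinRad (extForm lam) u) = 2 := by
  have h := finrank_span_eq_card (linearIndependent_sqrtMul hlam hu)
  rwa [Matrix.range_cons_cons_empty, ← trilinRad_eq_span hlam hu, Fintype.card_fin] at h

theorem trilinRad_eq_of_mem {lam : K} (hlam : ∀ x : K, x ^ 2 ≠ lam) {u v : Fin 6 → K}
    (hu : u ≠ 0) (hv : v ≠ 0) (h : v ∈ trilinRad (extForm lam) u) :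
    trilinRad (extForm lam) v = trilinRad (extForm lam) u := by
  refine Submodule.eq_of_le_of_finrank_eq ?_
    ((finrank_trilinRad hlam hv).trans (finrank_trilinRad hlam hu).symm)
  rw [trilinRad_eq_span hlam hv, Submodule.span_le]
  rintro w (rfl | rfl)
  · exact h
  · obtain ⟨c, d, rfl⟩ := (mem_trilinRad_iff hlam hu v).mp h
    refine (mem_trilinRad_iff hlam hu _).mpr ⟨d * lam, c, ?_⟩
    funext j
    fin_cases j <;> simp [sqrtMul] <;> ring

theorem self_mem_trilinRad (lam : K) (u : Fin 6 → K) : u ∈ trilinRad (extForm lam) u := by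
  simpa using smul_add_smul_sqrtMul_mem lam u 1 0

end ScalarExtension

/-- for `λ` not a square in `K` and
`χ = [123] + λ([156] + [345] + [426])` on `K^6`, every nonzero `u` has
`dim Rad_χ(u) = 2`, and the radicals form a line spread: every nonzero vector lies in
exactly one subspace of the form `Rad_χ(u)`, `u ≠ 0`. -/
theorem stmt12 (K : Type*) [Field K] (lam : K) (hlam : ∀ x : K, x ^ 2 ≠ lam)
    (χ : AlternatingMap K (Fin 6 → K) K (Fin 3))
    (hχ : χ = trip 0 1 2 + lam • (trip 0 4 5 + trip 2 3 4 + trip 3 1 5)) :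
    (∀ u : Fin 6 → K, u ≠ 0 → Module.finrank K (trilinRad χ u) = 2) ∧
    (∀ v : Fin 6 → K, v ≠ 0 →
      ∃! ℓ : Submodule K (Fin 6 → K),
        (∃ u : Fin 6 → K, u ≠ 0 ∧ ℓ = trilinRad χ u) ∧ v ∈ ℓ) := by
  subst hχ
  refine ⟨fun u hu => finrank_trilinRad hlam hu, fun v hv =>
    ⟨trilinRad (extForm lam) v, ⟨⟨v, hv, rfl⟩, self_mem_trilinRad lam v⟩, ?_⟩⟩
  rintro _ ⟨⟨u, hu, rfl⟩, hmem⟩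
  exact (trilinRad_eq_of_mem hlam hu hv hmem).symm
end
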